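/- Let K be a semifield. For every i ∈ ℐ and every (i',a') ∈ ℐ×K^ν there exists a ∈ K^ν with (i,a) ∼ (i',a'). Equivalently, every equivalence class in 𝒰_K contains a representative whose first component is any prescribed element of ℐ. -/

import Mathlib

open scoped BigOperators

namespace Lusztig

variable {I : Type*} [Fintype I] [DecidableEq I]

/-- A simply laced Cartan matrix: symmetric, positive definite, integer entries,
`2` on the diagonal and `0` or `-1` off the diagonal. -/
structure IsSimplyLacedCartan (A : Matrix I I ℤ) : Prop where
  symm : ∀ i j, A i j = A j i
  posDef : ∀ x : I → ℤ, x ≠ 0 → 0 < ∑ i, ∑ j, x i * A i j * x j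
  diag : ∀ i, A i i = 2
  offDiag : ∀ i j, i ≠ j → A i j = 0 ∨ A i j = -1

/-- The simple reflection `s_i` acting on `ℤ[I] = I → ℤ`, `s_i(j') = j' - a_{ij} i'`. -/
def sE (A : Matrix I I ℤ) (i : I) : Function.End (I → ℤ) :=
  fun x => x - (∑ j, A i j * x j) • Pi.single i 1

/-- The length of `w`: the least `n` such that `w` is a product of `n` simple
reflections (`∞` convention: `sInf ∅ = 0`). -/
noncomputable def len (A : Matrix I I ℤ) (w : Function.End (I → ℤ)) : ℕ :=
  sInf {n | ∃ l : List I, l.length = n ∧ (l.map (sE A)).prod = w}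

/-- `w₀` is the longest element of `W = ⟨s_i⟩` and `ν = |w₀|`. -/
structure IsLongest (A : Matrix I I ℤ) (w₀ : Function.End (I → ℤ)) (ν : ℕ) : Prop where
  mem : ∃ l : List I, (l.map (sE A)).prod = w₀
  len_eq : len A w₀ = ν
  longest : ∀ w : Function.End (I → ℤ),
    (∃ l : List I, (l.map (sE A)).prod = w) → len A w ≤ ν

/-- `ℐ`: the set of sequences `(i_1, …, i_ν)` with `s_{i_1} ⋯ s_{i_ν} = w₀`. -/
def RedWord (A : Matrix I I ℤ) (w₀ : Function.End (I → ℤ)) (ν : ℕ) :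
    Set (Fin ν → I) :=
  {f | ((List.ofFn f).map (sE A)).prod = w₀}

/-- The coefficient `r_{h,k}` defined by
`s_{i_1} ⋯ s_{i_{k-1}} (i_k') = Σ_h r_{h,k} h'` (here `k` is `0`-indexed). -/
def rCoef (A : Matrix I I ℤ) {ν : ℕ} (f : Fin ν → I) (h : I) (k : Fin ν) : ℤ :=
  ((List.ofFn fun m : Fin (k : ℕ) => sE A (f (Fin.castLE k.2.le m))).prod :
    Function.End (I → ℤ)) (Pi.single (f k) 1) h

/-- `‖i,a‖_h = Π_k a_k^{r_{h,k}}`. -/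
def normAt (A : Matrix I I ℤ) {ν : ℕ} {K : Type*} [CommGroup K]
    (f : Fin ν → I) (a : Fin ν → K) (h : I) : K :=
  ∏ k : Fin ν, a k ^ rCoef A f h k

section Semifield

variable {K : Type*} [CommGroup K] [AddCommSemigroup K]

/-- Adjacency of two pairs in `ℐ × K^ν`, for a semifield `K` (written
multiplicatively, with addition `+`). -/
def Adjacent (A : Matrix I I ℤ) (w₀ : Function.End (I → ℤ)) (ν : ℕ)
    (p q : (Fin ν → I) × (Fin ν → K)) : Prop :=
  p.1 ∈ RedWord A w₀ ν ∧ q.1 ∈ RedWord A w₀ ν ∧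
  ((∃ (l : ℕ) (h0 : l < ν) (h1 : l + 1 < ν) (h2 : l + 2 < ν),
      A (p.1 ⟨l, h0⟩) (p.1 ⟨l + 1, h1⟩) = -1 ∧
      p.1 ⟨l + 2, h2⟩ = p.1 ⟨l, h0⟩ ∧
      q.1 ⟨l, h0⟩ = p.1 ⟨l + 1, h1⟩ ∧ q.1 ⟨l + 1, h1⟩ = p.1 ⟨l, h0⟩ ∧
      q.1 ⟨l + 2, h2⟩ = p.1 ⟨l + 1, h1⟩ ∧
      (∀ k : Fin ν, (k : ℕ) ≠ l → (k : ℕ) ≠ l + 1 → (k : ℕ) ≠ l + 2 →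
        q.1 k = p.1 k ∧ q.2 k = p.2 k) ∧
      q.2 ⟨l, h0⟩ =
        p.2 ⟨l + 1, h1⟩ * p.2 ⟨l + 2, h2⟩ * (p.2 ⟨l, h0⟩ + p.2 ⟨l + 2, h2⟩)⁻¹ ∧
      q.2 ⟨l + 1, h1⟩ = p.2 ⟨l, h0⟩ + p.2 ⟨l + 2, h2⟩ ∧
      q.2 ⟨l + 2, h2⟩ =
        p.2 ⟨l, h0⟩ * p.2 ⟨l + 1, h1⟩ * (p.2 ⟨l, h0⟩ + p.2 ⟨l + 2, h2⟩)⁻¹) ∨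
   (∃ (l : ℕ) (h0 : l < ν) (h1 : l + 1 < ν),
      A (p.1 ⟨l, h0⟩) (p.1 ⟨l + 1, h1⟩) = 0 ∧
      q.1 ⟨l, h0⟩ = p.1 ⟨l + 1, h1⟩ ∧ q.1 ⟨l + 1, h1⟩ = p.1 ⟨l, h0⟩ ∧
      (∀ k : Fin ν, (k : ℕ) ≠ l → (k : ℕ) ≠ l + 1 →
        q.1 k = p.1 k ∧ q.2 k = p.2 k) ∧
      q.2 ⟨l, h0⟩ = p.2 ⟨l + 1, h1⟩ ∧ q.2 ⟨l + 1, h1⟩ = p.2 ⟨l, h0⟩))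

end Semifield

/-- Adjacency of two pairs in `ℐ × ℤ^ν` for the tropical semifield `ℤ`
(sum = `min`, product = `+`). -/
def TAdjacent (A : Matrix I I ℤ) (w₀ : Function.End (I → ℤ)) (ν : ℕ)
    (p q : (Fin ν → I) × (Fin ν → ℤ)) : Prop :=
  p.1 ∈ RedWord A w₀ ν ∧ q.1 ∈ RedWord A w₀ ν ∧
  ((∃ (l : ℕ) (h0 : l < ν) (h1 : l + 1 < ν) (h2 : l + 2 < ν),
      A (p.1 ⟨l, h0⟩) (p.1 ⟨l + 1, h1⟩) = -1 ∧
      p.1 ⟨l + 2, h2⟩ = p.1 ⟨l, h0⟩ ∧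
      q.1 ⟨l, h0⟩ = p.1 ⟨l + 1, h1⟩ ∧ q.1 ⟨l + 1, h1⟩ = p.1 ⟨l, h0⟩ ∧
      q.1 ⟨l + 2, h2⟩ = p.1 ⟨l + 1, h1⟩ ∧
      (∀ k : Fin ν, (k : ℕ) ≠ l → (k : ℕ) ≠ l + 1 → (k : ℕ) ≠ l + 2 →
        q.1 k = p.1 k ∧ q.2 k = p.2 k) ∧
      q.2 ⟨l, h0⟩ =
        p.2 ⟨l + 1, h1⟩ + p.2 ⟨l + 2, h2⟩ - min (p.2 ⟨l, h0⟩) (p.2 ⟨l + 2, h2⟩) ∧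
      q.2 ⟨l + 1, h1⟩ = min (p.2 ⟨l, h0⟩) (p.2 ⟨l + 2, h2⟩) ∧
      q.2 ⟨l + 2, h2⟩ =
        p.2 ⟨l, h0⟩ + p.2 ⟨l + 1, h1⟩ - min (p.2 ⟨l, h0⟩) (p.2 ⟨l + 2, h2⟩)) ∨
   (∃ (l : ℕ) (h0 : l < ν) (h1 : l + 1 < ν),
      A (p.1 ⟨l, h0⟩) (p.1 ⟨l + 1, h1⟩) = 0 ∧
      q.1 ⟨l, h0⟩ = p.1 ⟨l + 1, h1⟩ ∧ q.1 ⟨l + 1, h1⟩ = p.1 ⟨l, h0⟩ ∧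
      (∀ k : Fin ν, (k : ℕ) ≠ l → (k : ℕ) ≠ l + 1 →
        q.1 k = p.1 k ∧ q.2 k = p.2 k) ∧
      q.2 ⟨l, h0⟩ = p.2 ⟨l + 1, h1⟩ ∧ q.2 ⟨l + 1, h1⟩ = p.2 ⟨l, h0⟩))

/-- The bilinear form on `ℤ[I]` with Gram matrix `A`. -/
def form (A : Matrix I I ℤ) (x y : I → ℤ) : ℤ := ∑ i, ∑ j, x i * A i j * y j

/-- The reflection `x ↦ x - (β, x) β` attached to a vector `β` of square length `2`. -/
def reflection (A : Matrix I I ℤ) (β : I → ℤ) : Function.End (I → ℤ) :=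
  fun x => x - form A β x • β

omit [DecidableEq I] in
lemma form_add_right (A : Matrix I I ℤ) (x y z : I → ℤ) :
    form A x (y + z) = form A x y + form A x z := by
  simp [form, mul_add, Finset.sum_add_distrib]

omit [DecidableEq I] in
lemma form_smul_right (A : Matrix I I ℤ) (c : ℤ) (x y : I → ℤ) :
    form A x (c • y) = c * form A x y := by
  simp only [form, Finset.mul_sum, Pi.smul_apply, smul_eq_mul]
  exact Finset.sum_congr rfl fun i _ => Finset.sum_congr rfl fun j _ => by ring

omit [DecidableEq I] in
lemma form_sub_right (A : Matrix I I ℤ) (x y z : I → ℤ) :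
    form A x (y - z) = form A x y - form A x z := by
  simp [form, mul_sub, Finset.sum_sub_distrib]

section Symmetric

variable {A : Matrix I I ℤ}

omit [DecidableEq I] in
lemma form_comm (hA : ∀ i j, A i j = A j i) (x y : I → ℤ) : form A x y = form A y x := by
  unfold form
  rw [Finset.sum_comm]
  refine Finset.sum_congr rfl fun i _ => Finset.sum_congr rfl fun j _ => ?_
  rw [hA j i]; ring

omit [DecidableEq I] in
lemma form_sub_left (hA : ∀ i j, A i j = A j i) (x y z : I → ℤ) :
    form A (x - y) z = form A x z - form A y z := by
  rw [form_comm hA, form_sub_right, form_comm hA z, form_comm hA z]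

omit [DecidableEq I] in
lemma form_add_left (hA : ∀ i j, A i j = A j i) (x y z : I → ℤ) :
    form A (x + y) z = form A x z + form A y z := by
  rw [form_comm hA, form_add_right, form_comm hA z, form_comm hA z]

omit [DecidableEq I] in
lemma form_smul_left (hA : ∀ i j, A i j = A j i) (c : ℤ) (x y : I → ℤ) :
    form A (c • x) y = c * form A x y := by
  rw [form_comm hA, form_smul_right, form_comm hA]

omit [DecidableEq I] in
lemma form_reflection_reflection (hA : ∀ i j, A i j = A j i) {β : I → ℤ} (hβ : form A β β = 2)
    (x y : I → ℤ) : form A (reflection A β x) (reflection A β y) = form A x y := by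
  simp only [reflection, form_sub_left hA, form_sub_right, form_smul_left hA, form_smul_right, hβ,
    form_comm hA x β]
  ring

omit [DecidableEq I] in
lemma form_reflection_left (hA : ∀ i j, A i j = A j i) (β x y : I → ℤ) :
    form A (reflection A β x) y = form A x (reflection A β y) := by
  simp only [reflection, form_sub_left hA, form_sub_right, form_smul_left hA, form_smul_right,
    form_comm hA x β]
  ring

omit [DecidableEq I] in
lemma reflection_mul_self {β : I → ℤ} (hβ : form A β β = 2) : reflection A β * reflection A β = 1 := by
  funext x
  change reflection A β (reflection A β x) = x
  simp only [reflection, form_sub_right, form_smul_right, hβ]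
  funext i
  simp only [Pi.sub_apply, Pi.smul_apply, smul_eq_mul]
  ring

omit [DecidableEq I] in
lemma reflection_mul_reflection (hA : ∀ i j, A i j = A j i) {β γ : I → ℤ} (hβ : form A β β = 2) :
    reflection A β * reflection A (reflection A β γ) = reflection A γ * reflection A β := by
  funext x
  change reflection A β (reflection A (reflection A β γ) x) = reflection A γ (reflection A β x)
  conv_lhs => rw [reflection, reflection, form_reflection_left hA]
  have h := congrFun (reflection_mul_self hβ) γ
  change reflection A β (reflection A β γ) = γ at h
  conv_rhs => rw [reflection]
  set c := form A γ (reflection A β x)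
  rw [form_sub_right, form_smul_right, ← form_reflection_left hA]
  have h' : reflection A β β = -β := by
    funext i; simp [reflection, hβ]; ring
  funext i
  have hi := congrFun h i
  simp only [reflection, form_sub_right, form_smul_right, form_sub_left hA, form_smul_left hA, hβ,
    Pi.sub_apply, Pi.smul_apply, smul_eq_mul] at hi ⊢
  ring

end Symmetric

section Roots

variable {A : Matrix I I ℤ}

lemma form_single_left (A : Matrix I I ℤ) (i : I) (x : I → ℤ) :
    form A (Pi.single i 1) x = ∑ j, A i j * x j := by
  unfold form
  rw [Finset.sum_eq_single i]
  · simp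
  · intro b _ hb; simp [hb]
  · simp

lemma form_single_single (A : Matrix I I ℤ) (i j : I) :
    form A (Pi.single i 1) (Pi.single j 1) = A i j := by
  simp [form_single_left, Pi.single_apply]

lemma sE_eq_reflection (A : Matrix I I ℤ) (i : I) : sE A i = reflection A (Pi.single i 1) := by
  funext x
  simp only [sE, reflection, form_single_left]

lemma sE_single (A : Matrix I I ℤ) (i j : I) :
    sE A i (Pi.single j 1) = Pi.single j 1 - A i j • Pi.single i 1 := by
  rw [sE_eq_reflection, reflection, form_single_single]

lemma sE_apply_of_ne (A : Matrix I I ℤ) {i j : I} (h : j ≠ i) (x : I → ℤ) :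
    sE A i x j = x j := by
  simp [sE, h]

lemma even_form_self (hA : IsSimplyLacedCartan A) (x : I → ℤ) : Even (form A x x) := by
  rw [← Finset.univ_sum_single x]
  refine Finset.sum_induction _ (fun y => Even (form A y y)) ?_ ?_ ?_
  · intro y z hy hz
    have : form A (y + z) (y + z) = form A y y + form A z z + 2 * form A y z := by
      rw [form_add_right, form_add_left hA.symm, form_add_left hA.symm, form_comm hA.symm z y]
      ring
    rw [this]
    exact (hy.add hz).add (even_two_mul _)
  · simp [form]
  · intro i _
    have : (Pi.single i (x i) : I → ℤ) = x i • Pi.single i 1 := by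
      rw [← Pi.single_smul]; simp
    rw [this, form_smul_left hA.symm, form_smul_right, form_single_single, hA.diag]
    exact ((even_two).mul_left _).mul_left _

lemma two_le_form_self (hA : IsSimplyLacedCartan A) {x : I → ℤ} (hx : x ≠ 0) :
    2 ≤ form A x x := by
  have h := hA.posDef x hx
  change 0 < form A x x at h
  obtain ⟨c, hc⟩ := even_form_self hA x
  omega

/-- A vector of square length `2` has all its coordinates of the same sign. -/
lemma nonneg_or_nonpos (hA : IsSimplyLacedCartan A) {x : I → ℤ} (hx : form A x x = 2) :
    0 ≤ x ∨ x ≤ 0 := by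
  have hdec : x = x⁺ - x⁻ := (posPart_sub_negPart x).symm
  have hmix : form A x⁺ x⁻ ≤ 0 := by
    refine Finset.sum_nonpos fun i _ => Finset.sum_nonpos fun j _ => ?_
    have hp : 0 ≤ x⁺ i := posPart_nonneg x i
    have hn : 0 ≤ x⁻ j := negPart_nonneg x j
    by_cases hij : i = j
    · subst hij
      have h0 : x⁺ i = 0 ∨ x⁻ i = 0 := by
        rw [Pi.posPart_apply, Pi.negPart_apply, posPart_eq_zero, negPart_eq_zero]
        exact le_total _ _
      rcases h0 with h0 | h0 <;> simp [h0]
    · rcases hA.offDiag i j hij with h | h <;> rw [h]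
      · simp
      · nlinarith [mul_nonneg hp hn]
  have hexp : form A x x = form A x⁺ x⁺ + form A x⁻ x⁻ - 2 * form A x⁺ x⁻ := by
    conv_lhs => rw [hdec]
    rw [form_sub_right, form_sub_left hA.symm, form_sub_left hA.symm,
      form_comm hA.symm x⁻ x⁺]
    ring
  by_cases hp : x⁺ = 0
  · exact Or.inr (posPart_eq_zero.mp hp)
  by_cases hn : x⁻ = 0
  · exact Or.inl (negPart_eq_zero.mp hn)
  have := two_le_form_self hA hp
  have := two_le_form_self hA hn
  omega

lemma form_simple (hA : IsSimplyLacedCartan A) (i : I) :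
    form A (Pi.single i 1) (Pi.single i 1) = 2 := by
  rw [form_single_single, hA.diag]

lemma form_sE_sE (hA : IsSimplyLacedCartan A) (i : I) (x : I → ℤ) :
    form A (sE A i x) (sE A i x) = form A x x := by
  rw [sE_eq_reflection, form_reflection_reflection hA.symm (form_simple hA i)]

lemma sE_mul_self (hA : IsSimplyLacedCartan A) (i : I) : sE A i * sE A i = 1 := by
  rw [sE_eq_reflection, reflection_mul_self (form_simple hA i)]

lemma sE_neg (A : Matrix I I ℤ) (i : I) (x : I → ℤ) : sE A i (-x) = -sE A i x := by
  funext j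
  simp [sE]
  ring

/-- `s_i` permutes the positive roots other than the simple root `i'`. -/
lemma sE_nonneg (hA : IsSimplyLacedCartan A) {i : I} {β : I → ℤ} (hβ : form A β β = 2)
    (h0 : 0 ≤ β) (hne : β ≠ Pi.single i 1) : 0 ≤ sE A i β := by
  rcases nonneg_or_nonpos hA ((form_sE_sE hA i β).trans hβ) with h | h
  · exact h
  exfalso
  apply hne
  have hsupp : β = β i • Pi.single i 1 := by
    funext j
    by_cases hj : j = i
    · subst hj; simp
    · have h1 := h j
      rw [sE_apply_of_ne A hj] at h1
      have h2 := h0 j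
      simp only [Pi.zero_apply] at h1 h2
      simp [hj]; omega
  have hsq : β i * (β i * 2) = 2 := by
    rw [hsupp, form_smul_left hA.symm, form_smul_right, form_simple hA] at hβ
    exact hβ
  have hi : 0 ≤ β i := h0 i
  have : β i = 1 := by nlinarith
  rw [hsupp, this, one_smul]

end Roots

section Words

variable {A : Matrix I I ℤ}

/-- The product of the simple reflections along a word. -/
def wordProd (A : Matrix I I ℤ) (l : List I) : Function.End (I → ℤ) := (l.map (sE A)).prod

lemma wordProd_cons (A : Matrix I I ℤ) (i : I) (l : List I) :
    wordProd A (i :: l) = sE A i * wordProd A l := by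
  simp [wordProd]

lemma wordProd_append (A : Matrix I I ℤ) (l l' : List I) :
    wordProd A (l ++ l') = wordProd A l * wordProd A l' := by
  simp [wordProd]

lemma sE_mul_cancel_left (hA : IsSimplyLacedCartan A) (i : I) (w : Function.End (I → ℤ)) :
    sE A i * (sE A i * w) = w := by
  rw [← mul_assoc, sE_mul_self hA, one_mul]

lemma wordProd_mul_reverse (hA : IsSimplyLacedCartan A) (l : List I) :
    wordProd A l * wordProd A l.reverse = 1 := by
  induction l with
  | nil => simp [wordProd]
  | cons i l ih =>
    rw [List.reverse_cons, wordProd_append, wordProd_cons, mul_assoc,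
      ← mul_assoc (wordProd A l), ih, one_mul]
    simpa [wordProd] using sE_mul_self hA i

lemma wordProd_right_cancel (hA : IsSimplyLacedCartan A) {l : List I}
    {u v : Function.End (I → ℤ)} (h : u * wordProd A l = v * wordProd A l) : u = v := by
  have := congrArg (· * wordProd A l.reverse) h
  simpa [mul_assoc, wordProd_mul_reverse hA] using this

lemma wordProd_neg (A : Matrix I I ℤ) (l : List I) (x : I → ℤ) :
    wordProd A l (-x) = -wordProd A l x := by
  induction l with
  | nil => rfl
  | cons i l ih =>
    rw [wordProd_cons]
    change sE A i (wordProd A l (-x)) = -sE A i (wordProd A l x)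
    rw [ih, sE_neg]

lemma form_wordProd (hA : IsSimplyLacedCartan A) (l : List I) (x : I → ℤ) :
    form A (wordProd A l x) (wordProd A l x) = form A x x := by
  induction l with
  | nil => rfl
  | cons i l ih =>
    rw [wordProd_cons]
    exact (form_sE_sE hA i _).trans ih

lemma wordProd_reverse_cons (A : Matrix I I ℤ) (i : I) (l : List I) (x : I → ℤ) :
    wordProd A (i :: l).reverse x = wordProd A l.reverse (sE A i x) := by
  rw [List.reverse_cons, wordProd_append]
  simp [wordProd]
  rfl

/-- If the inverse of a word sends a positive root `β` to a root that is not positive, then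
multiplying by the reflection in `β` deletes a letter of the word. -/
lemma exists_eraseIdx_of_not_nonneg (hA : IsSimplyLacedCartan A) (l : List I) {β : I → ℤ}
    (hβ : form A β β = 2) (h0 : 0 ≤ β) (hneg : ¬ 0 ≤ wordProd A l.reverse β) :
    ∃ k < l.length, reflection A β * wordProd A l = wordProd A (l.eraseIdx k) := by
  induction l generalizing β with
  | nil => exact absurd h0 hneg
  | cons j l ih =>
    by_cases hj : β = Pi.single j 1
    · refine ⟨0, by simp, ?_⟩
      rw [hj, ← sE_eq_reflection, wordProd_cons, sE_mul_cancel_left hA]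
      rfl
    · rw [wordProd_reverse_cons] at hneg
      obtain ⟨k, hk, h⟩ := ih ((form_sE_sE hA j β).trans hβ) (sE_nonneg hA hβ h0 hj) hneg
      refine ⟨k + 1, by simpa using hk, ?_⟩
      rw [List.eraseIdx_cons_succ, wordProd_cons, wordProd_cons, ← h, ← mul_assoc, ← mul_assoc,
        sE_eq_reflection, reflection_mul_reflection hA.symm (form_simple hA j)]

/-- A word is reduced if no shorter word has the same product. -/
def IsReducedWord (A : Matrix I I ℤ) (l : List I) : Prop :=
  ∀ m : List I, wordProd A m = wordProd A l → l.length ≤ m.length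

lemma IsReducedWord.tail {i : I} {l : List I} (h : IsReducedWord A (i :: l)) :
    IsReducedWord A l := by
  intro m hm
  have := h (i :: m) (by rw [wordProd_cons, wordProd_cons, hm])
  simpa using this

lemma IsReducedWord.congr {l l' : List I} (h : IsReducedWord A l)
    (hp : wordProd A l' = wordProd A l) (hl : l'.length = l.length) : IsReducedWord A l' :=
  fun m hm => hl ▸ h m (hm.trans hp)

/-- The exchange condition. -/
lemma IsReducedWord.exchange (hA : IsSimplyLacedCartan A) {i : I} {u l : List I}
    (hu : IsReducedWord A (i :: u)) (h : wordProd A l = wordProd A (i :: u)) :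
    ∃ k < l.length, wordProd A u = wordProd A (l.eraseIdx k) := by
  have hα := form_simple hA i
  have hα0 : (0 : I → ℤ) ≤ Pi.single i 1 := by simp
  have hpos : 0 ≤ wordProd A u.reverse (Pi.single i 1) := by
    by_contra hneg
    obtain ⟨k, hk, hk'⟩ := exists_eraseIdx_of_not_nonneg hA u hα hα0 hneg
    rw [← sE_eq_reflection, ← wordProd_cons] at hk'
    have := hu _ hk'.symm
    rw [List.length_eraseIdx_of_lt hk] at this
    simp at this
    omega
  have hrev : wordProd A l.reverse = wordProd A (i :: u).reverse := by
    have h1 := wordProd_mul_reverse hA (i :: u)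
    have h2 := wordProd_mul_reverse hA l.reverse
    rw [List.reverse_reverse, h] at h2
    calc wordProd A l.reverse
        = wordProd A l.reverse * (wordProd A (i :: u) * wordProd A (i :: u).reverse) := by
          rw [h1, mul_one]
      _ = _ := by rw [← mul_assoc, h2, one_mul]
  have hneg : ¬ 0 ≤ wordProd A l.reverse (Pi.single i 1) := by
    rw [hrev, wordProd_reverse_cons, sE_single, hA.diag]
    have : (Pi.single i 1 - (2 : ℤ) • Pi.single i 1 : I → ℤ) = -Pi.single i 1 := by
      rw [two_smul]; abel
    rw [this, wordProd_neg]
    intro hc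
    have hz : wordProd A u.reverse (Pi.single i 1) = 0 :=
      le_antisymm (neg_nonneg.mp hc) hpos
    have := form_wordProd hA u.reverse (Pi.single i 1)
    rw [hz, hα] at this
    simp [form] at this
  obtain ⟨k, hk, hk'⟩ := exists_eraseIdx_of_not_nonneg hA l hα hα0 hneg
  refine ⟨k, hk, ?_⟩
  rw [← hk', h, wordProd_cons, ← sE_eq_reflection, sE_mul_cancel_left hA]

lemma sE_ne_sE (hA : IsSimplyLacedCartan A) {i j : I} (hij : i ≠ j) : sE A i ≠ sE A j := by
  intro h
  have h1 := congrFun (congrFun h (Pi.single i 1)) i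
  rw [sE_single, sE_single, hA.diag] at h1
  simp [hij] at h1

lemma sE_commute (hA : IsSimplyLacedCartan A) {i j : I} (hij : A i j = 0) :
    sE A i * sE A j = sE A j * sE A i := by
  have h := reflection_mul_reflection hA.symm (γ := Pi.single j 1) (form_simple hA i)
  rw [← sE_eq_reflection, sE_single, hij, zero_smul, sub_zero, ← sE_eq_reflection] at h
  exact h

lemma sE_braid (hA : IsSimplyLacedCartan A) {i j : I} (hij : A i j = -1) :
    sE A i * (sE A j * sE A i) = sE A j * (sE A i * sE A j) := by
  have hi := reflection_mul_reflection hA.symm (γ := Pi.single j 1) (form_simple hA i)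
  have hj := reflection_mul_reflection hA.symm (γ := Pi.single i 1) (form_simple hA j)
  rw [← sE_eq_reflection, ← sE_eq_reflection, sE_single] at hi hj
  rw [hA.symm j i] at hj
  have hsum : (Pi.single i 1 - A i j • Pi.single j 1 : I → ℤ) =
      Pi.single j 1 - A i j • Pi.single i 1 := by
    rw [hij]; simp [add_comm]
  rw [hsum] at hj
  rw [← hi, ← hj, sE_mul_cancel_left hA, sE_mul_cancel_left hA]

lemma sE_not_commute (hA : IsSimplyLacedCartan A) {i j : I} (hij : A i j = -1) :
    sE A i * sE A j ≠ sE A j * sE A i := by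
  intro h
  have h1 := congrFun (congrFun h (Pi.single i 1)) i
  change sE A i (sE A j (Pi.single i 1)) i = sE A j (sE A i (Pi.single i 1)) i
    at h1
  have hne : i ≠ j := by
    rintro rfl
    rw [hA.diag] at hij
    omega
  rw [sE_apply_of_ne A hne, sE_single, sE_single, hA.symm j i, hij, hA.diag] at h1
  simp [sE_eq_reflection, reflection, form_add_right, form_single_single, hij, hA.diag,
    hne] at h1

/-- A single commutation or braid move between words. -/
inductive BraidMove (A : Matrix I I ℤ) : List I → List I → Prop
  | comm (xs ys : List I) (i j : I) (h : A i j = 0) :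
      BraidMove A (xs ++ i :: j :: ys) (xs ++ j :: i :: ys)
  | braid (xs ys : List I) (i j : I) (h : A i j = -1) :
      BraidMove A (xs ++ i :: j :: i :: ys) (xs ++ j :: i :: j :: ys)

omit [Fintype I] [DecidableEq I] in
lemma BraidMove.cons {l l' : List I} (a : I) (h : BraidMove A l l') :
    BraidMove A (a :: l) (a :: l') := by
  cases h with
  | comm xs ys i j h => exact .comm (a :: xs) ys i j h
  | braid xs ys i j h => exact .braid (a :: xs) ys i j h

omit [Fintype I] [DecidableEq I] in
lemma BraidMove.length_eq {l l' : List I} (h : BraidMove A l l') : l'.length = l.length := by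
  cases h <;> simp

lemma BraidMove.wordProd_eq (hA : IsSimplyLacedCartan A) {l l' : List I}
    (h : BraidMove A l l') : wordProd A l' = wordProd A l := by
  cases h with
  | comm xs ys i j h =>
    simp only [wordProd_append, wordProd_cons]
    rw [← mul_assoc (sE A j), ← sE_commute hA h, mul_assoc]
  | braid xs ys i j h =>
    simp only [wordProd_append, wordProd_cons]
    congr 1
    simpa only [mul_assoc] using congrArg (· * wordProd A ys) (sE_braid hA h).symm

/-- Two reduced words with the same product are related by braid moves. -/
theorem IsReducedWord.reflTransGen_braidMove (hA : IsSimplyLacedCartan A) {l l' : List I}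
    (hr : IsReducedWord A l) (hlen : l'.length = l.length)
    (hp : wordProd A l' = wordProd A l) : Relation.ReflTransGen (BraidMove A) l l' := by
  induction hn : l.length generalizing l l' with
  | zero =>
    rw [hn, List.length_eq_zero_iff] at hlen
    rw [List.length_eq_zero_iff] at hn
    rw [hn, hlen]
  | succ n ih =>
    have same : ∀ {a : I} {u v : List I}, IsReducedWord A (a :: u) → u.length = n →
        v.length = n → wordProd A (a :: v) = wordProd A (a :: u) →
        Relation.ReflTransGen (BraidMove A) (a :: u) (a :: v) := by
      intro a u v hu hun hvn h
      have h' : wordProd A v = wordProd A u := by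
        rw [← sE_mul_cancel_left hA a (wordProd A v), ← wordProd_cons, h, wordProd_cons,
          sE_mul_cancel_left hA]
      exact (ih hu.tail (hvn.trans hun.symm) h' hun).lift (a :: ·) fun _ _ => BraidMove.cons a
    match l, l', hn, hlen with
    | i :: u, j :: v, hn, hlen =>
      have hun : u.length = n := by simpa using hn
      have hvn : v.length = n := by simp at hlen; omega
      have hr' : IsReducedWord A (j :: v) := hr.congr hp hlen
      by_cases hij : i = j
      · subst hij
        exact same hr hun hvn hp
      obtain ⟨k, hk, hk'⟩ := hr.exchange hA hp
      match k, hk, hk' with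
      | 0, _, hk' =>
        rw [List.eraseIdx_cons_zero] at hk'
        rw [wordProd_cons, wordProd_cons, hk'] at hp
        exact absurd (wordProd_right_cancel hA hp).symm (sE_ne_sE hA hij)
      | k + 1, hk, hk' =>
        rw [List.eraseIdx_cons_succ] at hk'
        have hkv : k < v.length := by simpa using hk
        have hlen1 := List.length_eraseIdx_add_one hkv
        generalize v.eraseIdx k = v₁ at hk' hlen1
        have hp1 : wordProd A (i :: j :: v₁) = wordProd A (i :: u) := by
          rw [wordProd_cons, ← hk', ← wordProd_cons]
        have h1 : Relation.ReflTransGen (BraidMove A) (i :: u) (i :: j :: v₁) :=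
          same hr hun (by simp; omega) hp1
        rcases hA.offDiag i j hij with h0 | hm
        · have hmove : BraidMove A (i :: j :: v₁) (j :: i :: v₁) := .comm [] v₁ i j h0
          refine (h1.tail hmove).trans (same (hr.congr ?_ ?_) ?_ hvn ?_)
          · rw [hmove.wordProd_eq hA, hp1]
          · simp; omega
          · simp; omega
          · rw [hmove.wordProd_eq hA, hp1, hp]
        · obtain ⟨m, hm1, hm'⟩ := hr'.exchange hA (hp1.trans hp.symm)
          match m, hm1, hm' with
          | 0, _, hm' =>
            rw [List.eraseIdx_cons_zero, wordProd_cons] at hm'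
            have := hr' v₁ (by rw [wordProd_cons, hm', sE_mul_cancel_left hA])
            simp at this
            omega
          | 1, _, hm' =>
            rw [List.eraseIdx_cons_succ, List.eraseIdx_cons_zero, wordProd_cons] at hm'
            rw [← hp, wordProd_cons, wordProd_cons, wordProd_cons, hm', ← mul_assoc,
              ← mul_assoc] at hp1
            exact absurd (wordProd_right_cancel hA hp1) (sE_not_commute hA hm)
          | m + 2, hm1, hm' =>
            rw [List.eraseIdx_cons_succ, List.eraseIdx_cons_succ] at hm'
            have hmv : m < v₁.length := by simpa using hm1
            have hlen2 := List.length_eraseIdx_add_one hmv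
            generalize v₁.eraseIdx m = v₂ at hm' hlen2
            have hp2 : wordProd A (j :: i :: j :: v₂) = wordProd A (j :: v) := by
              rw [wordProd_cons, ← hm', ← wordProd_cons]
            have hmove : BraidMove A (i :: j :: i :: v₂) (j :: i :: j :: v₂) :=
              .braid [] v₂ i j hm
            have hp3 := (hmove.wordProd_eq hA).symm.trans (hp2.trans hp)
            have h2 : Relation.ReflTransGen (BraidMove A) (i :: u) (i :: j :: i :: v₂) :=
              same hr hun (by simp; omega) hp3
            refine (h2.tail hmove).trans (same (hr'.congr hp2 ?_) ?_ hvn hp2.symm)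
            · simp; omega
            · simp; omega

end Words

section Lift

variable {K : Type*} [CommGroup K] [AddCommSemigroup K]

/-- A braid move between the first components of pairs lifts to an adjacency. -/
lemma BraidMove.exists_adjacent {A : Matrix I I ℤ} {w₀ : Function.End (I → ℤ)} {ν : ℕ}
    {g g' : Fin ν → I} (h : BraidMove A (List.ofFn g) (List.ofFn g'))
    (hg : g ∈ RedWord A w₀ ν) (hg' : g' ∈ RedWord A w₀ ν) (a : Fin ν → K) :
    ∃ a' : Fin ν → K, Adjacent A w₀ ν (g, a) (g', a') := by
  have key : ∀ (f : Fin ν → I) (l : List I), List.ofFn f = l →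
      ∀ k (hk : k < ν), l[k]? = some (f ⟨k, hk⟩) := by
    rintro f _ rfl k hk
    simp [hk]
  generalize hl : List.ofFn g = l at h
  generalize hl' : List.ofFn g' = l' at h
  have hlen : l.length = ν := by rw [← hl, List.length_ofFn]
  replace hl := key g l hl
  replace hl' := key g' l' hl'
  cases h with
  | comm xs ys i j h =>
    have h0 : xs.length < ν := by simp at hlen; omega
    have h1 : xs.length + 1 < ν := by simp at hlen; omega
    have e0 := hl _ h0
    have e1 := hl _ h1
    have e0' := hl' _ h0
    have e1' := hl' _ h1
    simp at e0 e1 e0' e1'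
    refine ⟨fun k => if (k : ℕ) = xs.length then a ⟨_, h1⟩ else
      if (k : ℕ) = xs.length + 1 then a ⟨_, h0⟩ else a k, hg, hg',
      Or.inr ⟨xs.length, h0, h1, ?_⟩⟩
    simp only [← e0, ← e1, ← e0', ← e1']
    refine ⟨h, trivial, trivial, fun k hk0 hk1 => ⟨?_, by simp [hk0, hk1]⟩, by simp, by simp⟩
    have ek := hl k k.2
    have ek' := hl' k k.2
    rw [← Option.some_inj, ← ek, ← ek', List.getElem?_append, List.getElem?_append]
    split_ifs with hk
    · rfl
    · obtain ⟨m, hm⟩ : ∃ m, (k : ℕ) - xs.length = m + 2 := ⟨k - xs.length - 2, by omega⟩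
      simp [hm]
  | braid xs ys i j h =>
    have h0 : xs.length < ν := by simp at hlen; omega
    have h1 : xs.length + 1 < ν := by simp at hlen; omega
    have h2 : xs.length + 2 < ν := by simp at hlen; omega
    have e0 := hl _ h0
    have e1 := hl _ h1
    have e2 := hl _ h2
    have e0' := hl' _ h0
    have e1' := hl' _ h1
    have e2' := hl' _ h2
    simp at e0 e1 e2 e0' e1' e2'
    refine ⟨fun k =>
      if (k : ℕ) = xs.length then
        a ⟨_, h1⟩ * a ⟨_, h2⟩ * (a ⟨_, h0⟩ + a ⟨_, h2⟩)⁻¹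
      else if (k : ℕ) = xs.length + 1 then a ⟨_, h0⟩ + a ⟨_, h2⟩
      else if (k : ℕ) = xs.length + 2 then
        a ⟨_, h0⟩ * a ⟨_, h1⟩ * (a ⟨_, h0⟩ + a ⟨_, h2⟩)⁻¹
      else a k, hg, hg', Or.inl ⟨xs.length, h0, h1, h2, ?_⟩⟩
    simp only [← e0, ← e1, ← e2, ← e0', ← e1', ← e2']
    refine ⟨h, trivial, trivial, trivial, trivial,
      fun k hk0 hk1 hk2 => ⟨?_, by simp [hk0, hk1, hk2]⟩, by simp, by simp, by simp⟩
    have ek := hl k k.2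
    have ek' := hl' k k.2
    rw [← Option.some_inj, ← ek, ← ek', List.getElem?_append, List.getElem?_append]
    split_ifs with hk
    · rfl
    · obtain ⟨m, hm⟩ : ∃ m, (k : ℕ) - xs.length = m + 3 := ⟨k - xs.length - 3, by omega⟩
      simp [hm]

/-- A chain of braid moves starting at the first component of a pair lifts to a chain of
adjacencies. -/
lemma exists_eqvGen_of_reflTransGen {A : Matrix I I ℤ} (hA : IsSimplyLacedCartan A)
    {w₀ : Function.End (I → ℤ)} {ν : ℕ} {g : Fin ν → I} (hg : g ∈ RedWord A w₀ ν)
    (a : Fin ν → K) {l : List I}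
    (h : Relation.ReflTransGen (BraidMove A) (List.ofFn g) l) :
    ∃ g' ∈ RedWord A w₀ ν, List.ofFn g' = l ∧
      ∃ a' : Fin ν → K, Relation.EqvGen (Adjacent A w₀ ν) (g', a') (g, a) := by
  induction h with
  | refl => exact ⟨g, hg, rfl, a, .refl _⟩
  | @tail l l' _ hmove ih =>
    obtain ⟨g₁, hg₁, rfl, a₁, ha₁⟩ := ih
    have hlen : l'.length = ν := by rw [hmove.length_eq, List.length_ofFn]
    subst hlen
    have hofFn : List.ofFn l'.get = l' := List.ofFn_get l'
    have hg' : l'.get ∈ RedWord A w₀ l'.length := by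
      have := hmove.wordProd_eq hA
      change wordProd A (List.ofFn l'.get) = w₀
      rw [hofFn, this]
      exact hg₁
    obtain ⟨a', ha'⟩ := BraidMove.exists_adjacent (g' := l'.get) (by rwa [hofFn]) hg₁ hg' a₁
    exact ⟨l'.get, hg', hofFn, a', (Relation.EqvGen.symm _ _ (.rel _ _ ha')).trans _ _ _ ha₁⟩

end Lift

/-- every equivalence class in `𝒰_K` contains a representative
whose first component is any prescribed reduced word `f ∈ ℐ`. -/
theorem exists_representative (A : Matrix I I ℤ) (hA : IsSimplyLacedCartan A)
    (w₀ : Function.End (I → ℤ)) (ν : ℕ) (hw : IsLongest A w₀ ν)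
    {K : Type*} [CommGroup K] [AddCommSemigroup K]
    (hdist : ∀ a b c : K, a * (b + c) = a * b + a * c)
    (f : Fin ν → I) (hf : f ∈ RedWord A w₀ ν)
    (p : (Fin ν → I) × (Fin ν → K)) (hp : p.1 ∈ RedWord A w₀ ν) :
    ∃ a : Fin ν → K, Relation.EqvGen (Adjacent A w₀ ν) (f, a) p := by
  have hred : IsReducedWord A (List.ofFn p.1) := by
    intro m hm
    rw [List.length_ofFn, ← hw.len_eq]
    exact Nat.sInf_le ⟨m, rfl, hm.trans hp⟩
  obtain ⟨g, -, hgf, a, ha⟩ := exists_eqvGen_of_reflTransGen hA hp p.2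
    (hred.reflTransGen_braidMove hA (l' := List.ofFn f) (by simp) (hf.trans hp.symm))
  obtain rfl := List.ofFn_injective hgf
  exact ⟨a, ha⟩

end Lusztig
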